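/- Let P = ⟨H,M,T⟩ be an abduction problem whose theory T is a set of clauses over a set V of n propositional variables, let Πₙ denote the set of all clauses over V, and let C = { c_γ : γ ∈ Πₙ }, D = { d_γ : γ ∈ Πₙ }, E = { e_γ : γ ∈ Πₙ } be sets of fresh propositional variables in one-to-one correspondence with Πₙ. For H₁ ⊆ H define H₂ = H₁ ∪ { c_γ : γ ∈ T } ∪ { d_γ : γ ∈ Πₙ \ T }, and define P' = ⟨H',M',T'⟩ by H' = H ∪ C ∪ D, M' = M ∪ E, and T' = { c_γ → e_γ : γ ∈ Πₙ } ∪ { d_γ → e_γ : γ ∈ Πₙ } ∪ { c_γ → γ : γ ∈ Πₙ }. Then H₁ is a ⊆-minimal solution of P if and only if H₂ is a ⊆-minimal solution of P', i.e. H₁ ∈ SOL_⊆(P) iff H₂ ∈ SOL_⊆(P'). -/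

import Mathlib

/-- Propositional formulas over a set `V` of variables. -/
inductive PropForm (V : Type) : Type where
  | fls  : PropForm V
  | var  : V → PropForm V
  | neg  : PropForm V → PropForm V
  | conj : PropForm V → PropForm V → PropForm V
  | disj : PropForm V → PropForm V → PropForm V
  | imp  : PropForm V → PropForm V → PropForm V
  deriving DecidableEq

namespace PropForm

/-- Truth of a formula under a valuation. -/
def eval {V : Type} (v : V → Prop) : PropForm V → Prop
  | fls => False
  | var x => v x
  | neg φ => ¬ eval v φ
  | conj φ ψ => eval v φ ∧ eval v ψ
  | disj φ ψ => eval v φ ∨ eval v ψ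
  | imp φ ψ => eval v φ → eval v ψ

/-- The set of variables occurring in a formula. -/
def vars {V : Type} : PropForm V → Set V
  | fls => ∅
  | var x => {x}
  | neg φ => vars φ
  | conj φ ψ => vars φ ∪ vars ψ
  | disj φ ψ => vars φ ∪ vars ψ
  | imp φ ψ => vars φ ∪ vars ψ

end PropForm

/-- An abduction problem `⟨H, M, T⟩`: hypotheses, manifestations, theory. -/
structure AbdProblem (V : Type) [DecidableEq V] : Type where
  H : Finset V
  M : Finset V
  T : Finset (PropForm V)

variable {V : Type} [DecidableEq V]

/-- `v` is a model of the hypotheses `A` together with the theory `T`. -/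
def models (v : V → Prop) (A : Finset V) (T : Finset (PropForm V)) : Prop :=
  (∀ x ∈ A, v x) ∧ (∀ φ ∈ T, φ.eval v)

/-- `A` is a solution of `P`: `A ⊆ H`, `A ∪ T` is satisfiable, `A ∪ T ⊨ m` for `m ∈ M`. -/
def isSol (P : AbdProblem V) (A : Finset V) : Prop :=
  A ⊆ P.H ∧ (∃ v, models v A P.T) ∧ ∀ v, models v A P.T → ∀ m ∈ P.M, v m

/-- The set of solutions of `P`. -/
def SOL (P : AbdProblem V) : Set (Finset V) := {A | isSol P A}

/-- The solutions of `P` minimal under set inclusion. -/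
def SOLsub (P : AbdProblem V) : Set (Finset V) :=
  {A | A ∈ SOL P ∧ ∀ B ∈ SOL P, B ⊆ A → B = A}

/-- The solutions of `P` of minimum cardinality. -/
def SOLcard (P : AbdProblem V) : Set (Finset V) :=
  {A | A ∈ SOL P ∧ ∀ B ∈ SOL P, A.card ≤ B.card}

/-- `x` is fresh for `P`: it occurs neither in `H`, nor in `M`, nor in any formula of `T`. -/
def freshFor (P : AbdProblem V) (x : V) : Prop :=
  x ∉ P.H ∧ x ∉ P.M ∧ ∀ φ ∈ P.T, x ∉ φ.vars

/-- A clause, given as a pair (positive variables, negated variables),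
    rendered as a disjunction of literals. -/
noncomputable def clauseForm (γ : Finset V × Finset V) : PropForm V :=
  (γ.1.toList.map PropForm.var
    ++ γ.2.toList.map (fun x => PropForm.neg (PropForm.var x))).foldr
    PropForm.disj PropForm.fls

/-- `Πₙ`: the set of all clauses over the variable set `W`. -/
def allClauses (W : Finset V) : Finset (Finset V × Finset V) :=
  W.powerset ×ˢ W.powerset

theorem PropForm.eval_congr {V : Type} {v w : V → Prop} :
    ∀ {φ : PropForm V}, (∀ x ∈ φ.vars, v x ↔ w x) → (φ.eval v ↔ φ.eval w)
  | .fls, _ => Iff.rfl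
  | .var x, h => h x rfl
  | .neg _, h => not_congr (eval_congr h)
  | .conj _ _, h => and_congr (eval_congr fun x hx => h x (Or.inl hx))
      (eval_congr fun x hx => h x (Or.inr hx))
  | .disj _ _, h => or_congr (eval_congr fun x hx => h x (Or.inl hx))
      (eval_congr fun x hx => h x (Or.inr hx))
  | .imp _ _, h => imp_congr (eval_congr fun x hx => h x (Or.inl hx))
      (eval_congr fun x hx => h x (Or.inr hx))

theorem exists_models_of_selection {ι : Type} (S : Finset ι) (c d e : ι → V)
    (he : Set.InjOn e ↑S)
    (hce : ∀ γ ∈ S, ∀ δ ∈ S, c γ ≠ e δ) (hde : ∀ γ ∈ S, ∀ δ ∈ S, d γ ≠ e δ)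
    (B : Finset V) (v : V → Prop) :
    ∃ w : V → Prop,
      (∀ γ ∈ S, w (c γ) ↔ c γ ∈ B) ∧ (∀ γ ∈ S, w (d γ) ↔ d γ ∈ B) ∧
      (∀ γ ∈ S, w (e γ) ↔ c γ ∈ B ∨ d γ ∈ B) ∧
      ∀ x, (∀ γ ∈ S, x ≠ c γ ∧ x ≠ d γ ∧ x ≠ e γ) → (w x ↔ v x) := by
  classical
  refine ⟨fun x => if ∃ γ ∈ S, x = c γ ∨ x = d γ then x ∈ B
    else if ∃ γ ∈ S, x = e γ then ∃ γ ∈ S, x = e γ ∧ (c γ ∈ B ∨ d γ ∈ B) else v x,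
    fun γ hγ => ?_, fun γ hγ => ?_, fun γ hγ => ?_, fun x hx => ?_⟩
  · dsimp only
    rw [if_pos ⟨γ, hγ, Or.inl rfl⟩]
  · dsimp only
    rw [if_pos ⟨γ, hγ, Or.inr rfl⟩]
  · dsimp only
    rw [if_neg, if_pos ⟨γ, hγ, rfl⟩]
    · constructor
      · rintro ⟨δ, hδ, h, hB⟩
        rwa [he hγ hδ h]
      · exact fun h => ⟨γ, hγ, rfl, h⟩
    · rintro ⟨δ, hδ, h | h⟩
      · exact hce δ hδ γ hγ h.symm
      · exact hde δ hδ γ hγ h.symm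
  · dsimp only
    rw [if_neg, if_neg]
    · rintro ⟨γ, hγ, h⟩
      exact (hx γ hγ).2.2 h
    · rintro ⟨γ, hγ, h | h⟩
      · exact (hx γ hγ).1 h
      · exact (hx γ hγ).2.1 h

theorem compile_preserves_subset_minimality (H M W : Finset V) (n : ℕ) (hW : W.card = n)
    (Tc : Finset (Finset V × Finset V)) (hTc : Tc ⊆ allClauses W)
    (c d e : Finset V × Finset V → V)
    (hcinj : Set.InjOn c ↑(allClauses W)) (hdinj : Set.InjOn d ↑(allClauses W))
    (heinj : Set.InjOn e ↑(allClauses W))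
    (hcfresh : ∀ γ ∈ allClauses W, freshFor ⟨H, M, Tc.image clauseForm⟩ (c γ))
    (hdfresh : ∀ γ ∈ allClauses W, freshFor ⟨H, M, Tc.image clauseForm⟩ (d γ))
    (hefresh : ∀ γ ∈ allClauses W, freshFor ⟨H, M, Tc.image clauseForm⟩ (e γ))
    (hcd : ∀ γ ∈ allClauses W, ∀ δ ∈ allClauses W, c γ ≠ d δ)
    (hce : ∀ γ ∈ allClauses W, ∀ δ ∈ allClauses W, c γ ≠ e δ)
    (hde : ∀ γ ∈ allClauses W, ∀ δ ∈ allClauses W, d γ ≠ e δ)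
    (H₁ : Finset V) (hH₁ : H₁ ⊆ H) :
    H₁ ∈ SOLsub ⟨H, M, Tc.image clauseForm⟩ ↔
    H₁ ∪ Tc.image c ∪ (allClauses W \ Tc).image d ∈
      SOLsub (⟨H ∪ (allClauses W).image c ∪ (allClauses W).image d,
        M ∪ (allClauses W).image e,
        (allClauses W).image (fun γ => PropForm.imp (PropForm.var (c γ)) (PropForm.var (e γ)))
          ∪ (allClauses W).image (fun γ => PropForm.imp (PropForm.var (d γ)) (PropForm.var (e γ)))
          ∪ (allClauses W).image (fun γ => PropForm.imp (PropForm.var (c γ)) (clauseForm γ))⟩ :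
        AbdProblem V) := by
  set S := allClauses W
  set P : AbdProblem V := ⟨H, M, Tc.image clauseForm⟩ with hP
  set X := Tc.image c ∪ (S \ Tc).image d with hX
  set P' : AbdProblem V := ⟨_, _, _⟩ with hP'
  have models_iff (v : V → Prop) (B : Finset V) : models v B P'.T ↔
      (∀ x ∈ B, v x) ∧ ∀ γ ∈ S, (v (c γ) → v (e γ)) ∧ (v (d γ) → v (e γ)) ∧
        (v (c γ) → (clauseForm γ).eval v) := by
    simp only [models, hP', Finset.mem_union, Finset.mem_image]
    refine and_congr_right fun _ => ⟨fun h γ hγ => ⟨?_, ?_, ?_⟩, ?_⟩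
    · exact h _ (Or.inl (Or.inl ⟨γ, hγ, rfl⟩))
    · exact h _ (Or.inl (Or.inr ⟨γ, hγ, rfl⟩))
    · exact h _ (Or.inr ⟨γ, hγ, rfl⟩)
    · rintro h φ ((⟨γ, hγ, rfl⟩ | ⟨γ, hγ, rfl⟩) | ⟨γ, hγ, rfl⟩)
      · exact (h γ hγ).1
      · exact (h γ hγ).2.1
      · exact (h γ hγ).2.2
  have c_mem_X {γ} (hγ : γ ∈ S) : c γ ∈ X ↔ γ ∈ Tc := by
    simp only [hX, Finset.mem_union, Finset.mem_image, Finset.mem_sdiff]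
    constructor
    · rintro (⟨δ, hδ, h⟩ | ⟨δ, hδ, h⟩)
      · rwa [← hcinj (hTc hδ) hγ h]
      · exact absurd h.symm (hcd γ hγ δ hδ.1)
    · exact fun h => Or.inl ⟨γ, h, rfl⟩
  have d_mem_X {γ} (hγ : γ ∈ S) : d γ ∈ X ↔ γ ∉ Tc := by
    simp only [hX, Finset.mem_union, Finset.mem_image, Finset.mem_sdiff]
    constructor
    · rintro (⟨δ, hδ, h⟩ | ⟨δ, hδ, h⟩)
      · exact absurd h (hcd δ (hTc hδ) γ hγ)
      · rw [← hdinj hδ.1 hγ h]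
        exact hδ.2
    · exact fun h => Or.inr ⟨γ, ⟨hγ, h⟩, rfl⟩
  have mem_X {x} (hx : x ∈ X) : ∃ γ ∈ S, x = c γ ∨ x = d γ := by
    simp only [hX, Finset.mem_union, Finset.mem_image, Finset.mem_sdiff] at hx
    obtain ⟨γ, hγ, rfl⟩ | ⟨γ, hγ, rfl⟩ := hx
    · exact ⟨γ, hTc hγ, Or.inl rfl⟩
    · exact ⟨γ, hγ.1, Or.inr rfl⟩
  have X_disj {x} (hx : x ∈ X) : x ∉ H := by
    obtain ⟨γ, hγ, rfl | rfl⟩ := mem_X hx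
    · exact (hcfresh γ hγ).1
    · exact (hdfresh γ hγ).1
  have X_subset : X ⊆ P'.H := by
    intro x hx
    simp only [hP', Finset.mem_union, Finset.mem_image]
    obtain ⟨γ, hγ, rfl | rfl⟩ := mem_X hx
    · exact Or.inl (Or.inr ⟨γ, hγ, rfl⟩)
    · exact Or.inr ⟨γ, hγ, rfl⟩
  -- Any suitable valuation can be adjusted on the new variables to a model of the compiled theory.
  have adjust (B : Finset V) (v : V → Prop) (hB : B ⊆ H ∪ X) (hv : ∀ x ∈ B, x ∈ H → v x)
      (hT : ∀ γ ∈ Tc, c γ ∈ B → (clauseForm γ).eval v) :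
      ∃ w, models w B P'.T ∧ (∀ γ ∈ S, w (e γ) ↔ c γ ∈ B ∨ d γ ∈ B) ∧
        ∀ m ∈ M, w m ↔ v m := by
    obtain ⟨w, hc, hd, he, hw⟩ := exists_models_of_selection S c d e heinj hce hde B v
    have w_of_H {x} (hx : x ∈ H) : w x ↔ v x := hw x fun γ hγ =>
      ⟨fun h => (hcfresh γ hγ).1 (h ▸ hx), fun h => (hdfresh γ hγ).1 (h ▸ hx),
        fun h => (hefresh γ hγ).1 (h ▸ hx)⟩
    have w_of_M {x} (hx : x ∈ M) : w x ↔ v x := hw x fun γ hγ =>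
      ⟨fun h => (hcfresh γ hγ).2.1 (h ▸ hx), fun h => (hdfresh γ hγ).2.1 (h ▸ hx),
        fun h => (hefresh γ hγ).2.1 (h ▸ hx)⟩
    refine ⟨w, (models_iff w B).2 ⟨fun x hx => ?_, fun γ hγ => ⟨?_, ?_, fun h => ?_⟩⟩, he,
      fun m hm => w_of_M hm⟩
    · obtain hxH | hxX := Finset.mem_union.1 (hB hx)
      · exact (w_of_H hxH).2 (hv x hx hxH)
      · obtain ⟨γ, hγ, rfl | rfl⟩ := mem_X hxX
        · exact (hc γ hγ).2 hx
        · exact (hd γ hγ).2 hx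
    · rw [hc γ hγ, he γ hγ]
      exact Or.inl
    · rw [hd γ hγ, he γ hγ]
      exact Or.inr
    · have hcB := (hc γ hγ).1 h
      have hγT : γ ∈ Tc := by
        obtain hH | hX' := Finset.mem_union.1 (hB hcB)
        · exact absurd hH (hcfresh γ hγ).1
        · exact (c_mem_X hγ).1 hX'
      have hφ := Finset.mem_image_of_mem clauseForm hγT
      refine (PropForm.eval_congr fun x hx => hw x fun δ hδ => ?_).2 (hT γ hγT hcB)
      exact ⟨fun h => (hcfresh δ hδ).2.2 _ hφ (h ▸ hx),
        fun h => (hdfresh δ hδ).2.2 _ hφ (h ▸ hx), fun h => (hefresh δ hδ).2.2 _ hφ (h ▸ hx)⟩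
  have models_of_union {v A} (h : models v (A ∪ X) P'.T) : models v A P.T := by
    rw [models_iff] at h
    refine ⟨fun x hx => h.1 x (Finset.mem_union_left _ hx), fun φ hφ => ?_⟩
    obtain ⟨γ, hγ, rfl⟩ := Finset.mem_image.1 hφ
    exact (h.2 γ (hTc hγ)).2.2 (h.1 _ (Finset.mem_union_right _ ((c_mem_X (hTc hγ)).2 hγ)))
  have lift_model {v A} (hA : A ⊆ H) (h : models v A P.T) :
      ∃ w, models w (A ∪ X) P'.T ∧ ∀ m ∈ M, w m ↔ v m := by
    obtain ⟨w, hw, -, hM⟩ := adjust (A ∪ X) v (Finset.union_subset_union_left hA)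
      (fun x hx hxH => (Finset.mem_union.1 hx).elim (h.1 x) fun hX' => absurd hxH (X_disj hX'))
      fun γ hγ _ => h.2 _ (Finset.mem_image_of_mem _ hγ)
    exact ⟨w, hw, hM⟩
  have sol_iff {A : Finset V} (hA : A ⊆ H) : isSol P A ↔ isSol P' (A ∪ X) := by
    constructor
    · rintro ⟨-, ⟨v, hv⟩, hM⟩
      refine ⟨Finset.union_subset (fun x hx => ?_) X_subset, ?_, fun w hw m hm => ?_⟩
      · exact Finset.mem_union_left _ (Finset.mem_union_left _ (hA hx))
      · obtain ⟨w, hw, -⟩ := lift_model hA hv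
        exact ⟨w, hw⟩
      · obtain hm | hm := Finset.mem_union.1 hm
        · exact hM w (models_of_union hw) m hm
        · obtain ⟨γ, hγ, rfl⟩ := Finset.mem_image.1 hm
          rw [models_iff] at hw
          by_cases hγT : γ ∈ Tc
          · exact (hw.2 γ hγ).1 (hw.1 _ (Finset.mem_union_right _ ((c_mem_X hγ).2 hγT)))
          · exact (hw.2 γ hγ).2.1 (hw.1 _ (Finset.mem_union_right _ ((d_mem_X hγ).2 hγT)))
    · rintro ⟨-, ⟨v, hv⟩, hM⟩
      refine ⟨hA, ⟨v, models_of_union hv⟩, fun u hu m hm => ?_⟩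
      obtain ⟨w, hw, hwM⟩ := lift_model hA hu
      exact (hwM m hm).1 (hM w hw m (Finset.mem_union_left _ hm))
  have X_subset_of_sol {B : Finset V} (hB : B ⊆ H ∪ X) (h : isSol P' B) : X ⊆ B := by
    obtain ⟨-, ⟨v, hv⟩, hM⟩ := h
    obtain ⟨w, hw, he, -⟩ := adjust B v hB (fun x hx _ => hv.1 x hx) fun γ hγ hc =>
      (((models_iff v B).1 hv).2 γ (hTc hγ)).2.2 (hv.1 _ hc)
    have mem_or {γ} (hγ : γ ∈ S) : c γ ∈ B ∨ d γ ∈ B :=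
      (he γ hγ).1 (hM w hw _ (Finset.mem_union_right _ (Finset.mem_image_of_mem e hγ)))
    intro x hx
    obtain ⟨γ, hγ, rfl | rfl⟩ := mem_X hx
    · refine (mem_or hγ).resolve_right fun hd => ?_
      obtain hH | hX' := Finset.mem_union.1 (hB hd)
      · exact (hdfresh γ hγ).1 hH
      · exact (d_mem_X hγ).1 hX' ((c_mem_X hγ).1 hx)
    · refine (mem_or hγ).resolve_left fun hc => ?_
      obtain hH | hX' := Finset.mem_union.1 (hB hc)
      · exact (hcfresh γ hγ).1 hH
      · exact (d_mem_X hγ).1 hx ((c_mem_X hγ).1 hX')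
  rw [Finset.union_assoc]
  change (isSol P H₁ ∧ ∀ B, isSol P B → B ⊆ H₁ → B = H₁) ↔
    (isSol P' (H₁ ∪ X) ∧ ∀ B, isSol P' B → B ⊆ H₁ ∪ X → B = H₁ ∪ X)
  rw [sol_iff hH₁]
  refine and_congr_right fun _ => ⟨fun hmin B hB hBs => ?_, fun hmin B hB hBs => ?_⟩
  · have hBH := hBs.trans (Finset.union_subset_union_left hH₁)
    have hXB := X_subset_of_sol hBH hB
    have hBeq : B ∩ H ∪ X = B := by
      ext x
      have := @hBH x
      have := @hXB x
      simp only [Finset.mem_union, Finset.mem_inter] at *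
      tauto
    have hsub : B ∩ H ⊆ H₁ := fun x hx =>
      (Finset.mem_union.1 (hBs (Finset.mem_inter.1 hx).1)).resolve_right
        fun hX' => X_disj hX' (Finset.mem_inter.1 hx).2
    rw [← hBeq] at hB
    rw [← hBeq, hmin _ ((sol_iff Finset.inter_subset_right).2 hB) hsub]
  · have h := hmin _ ((sol_iff (hBs.trans hH₁)).1 hB) (Finset.union_subset_union_left hBs)
    refine hBs.antisymm fun x hx => ?_
    have hx' : x ∈ B ∪ X := h ▸ Finset.mem_union_left _ hx
    exact (Finset.mem_union.1 hx').resolve_right fun hX' => X_disj hX' (hH₁ hx)
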